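/- Let I be a compact Hausdorff space and let f_i : ℝ^m → ℝ, i ∈ I, be convex functions such that (i,x) ↦ f_i(x) is continuous on I × ℝ^m. Define f(x) := max{f_i(x) : i ∈ I} and I_f(x) := {i ∈ I : f_i(x) = f(x)}. Then for every x ∈ ℝ^m and every h ∈ ℝ^m, f'(x,h) = max_{i ∈ I_f(x)} f_i'(x,h). -/

import Mathlib

open Filter Metric Set Topology
open scoped ENNReal

noncomputable section

/-- The Euclidean space `ℝ^m`. -/
abbrev Euc (m : ℕ) := EuclideanSpace ℝ (Fin m)

/-- Directional derivative `g'(x,h) = inf_{t>0} (g(x+th) - g(x))/t` of a real-valued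
convex function. -/
def rDirDeriv {m : ℕ} (g : Euc m → ℝ) (x h : Euc m) : ℝ :=
  ⨅ t : {t : ℝ // 0 < t}, (g (x + (t : ℝ) • h) - g x) / (t : ℝ)

/-- `min_{‖h‖=1} g'(x,h)`. -/
def rMinDirDeriv {m : ℕ} (g : Euc m → ℝ) (x : Euc m) : ℝ :=
  ⨅ h : sphere (0 : Euc m) 1, rDirDeriv g x (h : Euc m)

/-- `f(x) = max_{i ∈ I} f_i(x)`. -/
def fmax {m : ℕ} {I : Type*} [Nonempty I] (F : I → Euc m → ℝ) (x : Euc m) : ℝ := ⨆ i, F i x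

/-- The active index set `I_f(x) = {i ∈ I : f_i(x) = f(x)}`. -/
def activeSet {m : ℕ} {I : Type*} [Nonempty I] (F : I → Euc m → ℝ) (x : Euc m) : Set I :=
  {i | F i x = fmax F x}

/-- The solution set `S_G = {x : g_i(x) ≤ 0 for all i ∈ I}` of the system. -/
def SG {m : ℕ} {I : Type*} (G : I → Euc m → ℝ) : Set (Euc m) := {x | ∀ i, G i x ≤ 0}

/-- The local error bound modulus `τ_min(G, x₀)` of the system (in `ℝ≥0∞`). -/
def tauMinLocSys {m : ℕ} {I : Type*} [Nonempty I] (G : I → Euc m → ℝ) (x₀ : Euc m) : ℝ≥0∞ :=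
  ⨅ τ ∈ {τ : ℝ | 0 < τ ∧ ∃ δ > (0:ℝ), ∀ x ∈ ball x₀ δ,
      EMetric.infEdist x (SG G) ≤ ENNReal.ofReal (τ * max (fmax G x) 0)},
    ENNReal.ofReal τ

/-- The global error bound modulus `τ_min(G)` of the system (in `ℝ≥0∞`). -/
def tauMinSys {m : ℕ} {I : Type*} [Nonempty I] (G : I → Euc m → ℝ) : ℝ≥0∞ :=
  ⨅ τ ∈ {τ : ℝ | 0 < τ ∧ ∀ x,
      EMetric.infEdist x (SG G) ≤ ENNReal.ofReal (τ * max (fmax G x) 0)},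
    ENNReal.ofReal τ

/-- The difference quotients of a convex function along a direction are bounded below. -/
lemma ConvexOn.bddBelow_range_quotient {m : ℕ} {g : Euc m → ℝ} (hg : ConvexOn ℝ Set.univ g)
    (x h : Euc m) :
    BddBelow (range fun t : {t : ℝ // 0 < t} => (g (x + (t : ℝ) • h) - g x) / (t : ℝ)) := by
  refine ⟨g x - g (x - h), ?_⟩
  rintro _ ⟨⟨t, ht⟩, rfl⟩
  have ht' : (0 : ℝ) < 1 + t := by linarith
  have key := hg.2 (mem_univ (x - h)) (mem_univ (x + t • h))
    (by positivity : 0 ≤ t / (1 + t)) (by positivity : 0 ≤ 1 / (1 + t)) (by field_simp; ring)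
  have hx : (t / (1 + t)) • (x - h) + (1 / (1 + t)) • (x + t • h) = x := by
    match_scalars <;> field_simp <;> ring
  rw [hx, smul_eq_mul, smul_eq_mul, div_mul_eq_mul_div, div_mul_eq_mul_div, ← add_div,
    le_div_iff₀ ht'] at key
  rw [le_div_iff₀ ht]
  linarith

lemma rDirDeriv_le_quotient {m : ℕ} {g : Euc m → ℝ} (hg : ConvexOn ℝ Set.univ g)
    (x h : Euc m) {t : ℝ} (ht : 0 < t) : rDirDeriv g x h ≤ (g (x + t • h) - g x) / t :=
  ciInf_le (hg.bddBelow_range_quotient x h) ⟨t, ht⟩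

/-- If a convex function lies above the ray `s ↦ c + s * L` at `x + s • h` while `g x ≤ c`, then
it lies above this ray at every later point. -/
lemma ConvexOn.ray_le_of_ray_le {m : ℕ} {g : Euc m → ℝ} (hg : ConvexOn ℝ Set.univ g)
    {x h : Euc m} {c L s t : ℝ} (hs : 0 < s) (hst : s ≤ t) (hx : g x ≤ c)
    (hgs : c + s * L ≤ g (x + s • h)) : c + t * L ≤ g (x + t • h) := by
  have ht : 0 < t := hs.trans_le hst
  have key := hg.2 (mem_univ x) (mem_univ (x + t • h))
    (div_nonneg (by linarith) ht.le : 0 ≤ (t - s) / t) (by positivity : 0 ≤ s / t)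
    (by field_simp; ring)
  have hxs : ((t - s) / t) • x + (s / t) • (x + t • h) = x + s • h := by
    match_scalars <;> field_simp <;> ring
  rw [hxs, smul_eq_mul, smul_eq_mul, div_mul_eq_mul_div, div_mul_eq_mul_div, ← add_div,
    le_div_iff₀ ht] at key
  have h1 : (t - s) * g x ≤ (t - s) * c := mul_le_mul_of_nonneg_left hx (by linarith)
  have h2 : (c + s * L) * t ≤ g (x + s • h) * t := mul_le_mul_of_nonneg_right hgs ht.le
  refine le_of_mul_le_mul_left ?_ hs
  linarith

section Compact

variable {m : ℕ} {I : Type*} [TopologicalSpace I] [CompactSpace I] [Nonempty I]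
  {F : I → Euc m → ℝ}

lemma le_fmax (hcont : Continuous fun p : I × Euc m => F p.1 p.2) (i : I) (y : Euc m) :
    F i y ≤ fmax F y := by
  have hc : Continuous fun i => F i y := hcont.comp (by fun_prop : Continuous fun i : I => (i, y))
  exact le_ciSup (isCompact_range hc).bddAbove i

lemma exists_eq_fmax (hcont : Continuous fun p : I × Euc m => F p.1 p.2) (y : Euc m) :
    ∃ i, F i y = fmax F y := by
  have hc : Continuous fun i => F i y := hcont.comp (by fun_prop : Continuous fun i : I => (i, y))
  exact (isCompact_range hc).sSup_mem (range_nonempty _)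

lemma rDirDeriv_le_quotient_fmax (hconv : ∀ i, ConvexOn ℝ Set.univ (F i))
    (hcont : Continuous fun p : I × Euc m => F p.1 p.2) {x : Euc m} (h : Euc m)
    {i : I} (hi : i ∈ activeSet F x) {t : ℝ} (ht : 0 < t) :
    rDirDeriv (F i) x h ≤ (fmax F (x + t • h) - fmax F x) / t := by
  have hix : F i x = fmax F x := hi
  refine (rDirDeriv_le_quotient (hconv i) x h ht).trans ?_
  rw [hix]
  gcongr
  exact le_fmax hcont i _

/-- Some single index stays above every supporting ray of the max-function. -/
lemma exists_forall_ray_le (hconv : ∀ i, ConvexOn ℝ Set.univ (F i))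
    (hcont : Continuous fun p : I × Euc m => F p.1 p.2) {x h : Euc m} {L : ℝ}
    (hL : ∀ t : ℝ, 0 < t → fmax F x + t * L ≤ fmax F (x + t • h)) :
    ∃ i, ∀ t : ℝ, 0 < t → fmax F x + t * L ≤ F i (x + t • h) := by
  let K : {t : ℝ // 0 < t} → Set I := fun t => {i | fmax F x + t * L ≤ F i (x + (t : ℝ) • h)}
  have hclosed : ∀ t, IsClosed (K t) := fun t =>
    isClosed_le continuous_const
      (hcont.comp (by fun_prop : Continuous fun i : I => (i, x + (t : ℝ) • h)))
  have hmono : ∀ s t : {t : ℝ // 0 < t}, s ≤ t → K s ⊆ K t := fun s t hst i hi =>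
    (hconv i).ray_le_of_ray_le s.2 hst (le_fmax hcont i x) hi
  have hdir : Directed (· ⊇ ·) K := fun s t =>
    ⟨min s t, hmono _ _ (min_le_left s t), hmono _ _ (min_le_right s t)⟩
  have hne : ∀ t, (K t).Nonempty := fun t => by
    obtain ⟨i, hi⟩ := exists_eq_fmax hcont (x + (t : ℝ) • h)
    exact ⟨i, (hL t t.2).trans hi.ge⟩
  have : Nonempty {t : ℝ // 0 < t} := ⟨⟨1, one_pos⟩⟩
  obtain ⟨i, hi⟩ := IsCompact.nonempty_iInter_of_directed_nonempty_isCompact_isClosed K hdir hne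
    (fun t => (hclosed t).isCompact) hclosed
  exact ⟨i, fun t ht => mem_iInter.1 hi ⟨t, ht⟩⟩

lemma mem_activeSet_of_forall_ray_le (hcont : Continuous fun p : I × Euc m => F p.1 p.2)
    {x h : Euc m} {L : ℝ} {i : I}
    (hi : ∀ t : ℝ, 0 < t → fmax F x + t * L ≤ F i (x + t • h)) : i ∈ activeSet F x := by
  refine le_antisymm (le_fmax hcont i x) ?_
  have hl : Tendsto (fun t : ℝ => fmax F x + t * L) (𝓝[>] 0) (𝓝 (fmax F x)) := by
    have hc : Continuous fun t : ℝ => fmax F x + t * L := by fun_prop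
    simpa using (hc.tendsto 0).mono_left nhdsWithin_le_nhds
  have hr : Tendsto (fun t : ℝ => F i (x + t • h)) (𝓝[>] 0) (𝓝 (F i x)) := by
    have hc : Continuous fun t : ℝ => F i (x + t • h) :=
      hcont.comp (by fun_prop : Continuous fun t : ℝ => (i, x + t • h))
    simpa using (hc.tendsto 0).mono_left nhdsWithin_le_nhds
  exact le_of_tendsto_of_tendsto hl hr (eventually_nhdsWithin_of_forall hi)

end Compact

/-- Proposition 4.1: for the sup-function of a compactly indexed
continuous family of convex functions, `f'(x,h) = max_{i ∈ I_f(x)} f_i'(x,h)`. -/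
theorem stmt15 {m : ℕ} {I : Type*} [TopologicalSpace I] [CompactSpace I] [T2Space I]
    [Nonempty I] (F : I → Euc m → ℝ) (hconv : ∀ i, ConvexOn ℝ Set.univ (F i))
    (hcont : Continuous fun p : I × Euc m => F p.1 p.2) (x h : Euc m) :
    rDirDeriv (fmax F) x h = ⨆ i : activeSet F x, rDirDeriv (F (i : I)) x h := by
  have : Nonempty {t : ℝ // 0 < t} := ⟨⟨1, one_pos⟩⟩
  obtain ⟨i₀, hi₀⟩ := exists_eq_fmax hcont x
  have : Nonempty (activeSet F x) := ⟨⟨i₀, hi₀⟩⟩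
  have hle : ∀ i : activeSet F x, rDirDeriv (F (i : I)) x h ≤ rDirDeriv (fmax F) x h := fun i =>
    le_ciInf fun t => rDirDeriv_le_quotient_fmax hconv hcont h i.2 t.2
  refine le_antisymm ?_ (ciSup_le hle)
  have hbdd : BddBelow (range fun t : {t : ℝ // 0 < t} =>
      (fmax F (x + (t : ℝ) • h) - fmax F x) / (t : ℝ)) := by
    refine ⟨rDirDeriv (F i₀) x h, ?_⟩
    rintro _ ⟨t, rfl⟩
    exact rDirDeriv_le_quotient_fmax hconv hcont h hi₀ t.2
  have hL : ∀ t : ℝ, 0 < t →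
      fmax F x + t * rDirDeriv (fmax F) x h ≤ fmax F (x + t • h) := fun t ht => by
    have hq : rDirDeriv (fmax F) x h ≤ (fmax F (x + t • h) - fmax F x) / t :=
      ciInf_le hbdd ⟨t, ht⟩
    rw [le_div_iff₀ ht] at hq
    linarith
  obtain ⟨i, hi⟩ := exists_forall_ray_le hconv hcont hL
  have hact := mem_activeSet_of_forall_ray_le hcont hi
  have hix : F i x = fmax F x := hact
  calc rDirDeriv (fmax F) x h ≤ rDirDeriv (F i) x h := le_ciInf fun t => by
        rw [le_div_iff₀ t.2, hix]
        linarith [hi t t.2]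
    _ ≤ ⨆ i : activeSet F x, rDirDeriv (F (i : I)) x h :=
        le_ciSup (f := fun i : activeSet F x => rDirDeriv (F (i : I)) x h)
          ⟨_, forall_mem_range.2 hle⟩ ⟨i, hact⟩
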